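/- arXiv:1504.06298 — 4 statements merged into one kernel-verified Lean document; each statement's English description precedes it below -/
import Mathlib

section
/- Let f be a convex function with L_f-Lipschitz continuous gradient that satisfies the global error bound on X with constant κ_f > 0. Then f satisfies the quadratic functional growth condition on X with constant κ_f²/L_f = μ_f·κ_f, where μ_f = κ_f/L_f, i.e., f(x) − f* ≥ (κ_f²/(2L_f))‖x − x̄‖² for all x ∈ X. -/
open Set
open scoped InnerProductSpace

section GradientDescent

variable {E : Type*} [NormedAddCommGroup E] [InnerProductSpace ℝ E]

/-- Variational inequality for a nearest point of a convex set. -/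
lemma inner_sub_nearest_le_zero {K : Set E} (hK : Convex ℝ K) {u v : E} (hv : v ∈ K)
    (hmin : ∀ w ∈ K, ‖u - v‖ ≤ ‖u - w‖) {w : E} (hw : w ∈ K) :
    ⟪u - v, w - v⟫_ℝ ≤ 0 := by
  have : Nonempty K := ⟨⟨v, hv⟩⟩
  refine (norm_eq_iInf_iff_real_inner_le_zero hK hv).1 (le_antisymm ?_ ?_) w hw
  · exact le_ciInf fun w => hmin w w.2
  · exact ciInf_le (f := fun w : K => ‖u - w‖)
      ⟨0, by rintro _ ⟨w, rfl⟩; exact norm_nonneg _⟩ ⟨v, hv⟩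

/-- Quadratic upper bound for a function whose gradient is Lipschitz on a convex set. -/
lemma le_quadratic_of_lipschitz_gradient [CompleteSpace E] {K : Set E} (hK : Convex ℝ K)
    {f : E → ℝ} {f' : E → E} {L : ℝ} (hgrad : ∀ x, HasGradientAt f (f' x) x)
    (hLip : ∀ x ∈ K, ∀ y ∈ K, ‖f' x - f' y‖ ≤ L * ‖x - y‖)
    {x y : E} (hx : x ∈ K) (hy : y ∈ K) :
    f y ≤ f x + ⟪f' x, y - x⟫_ℝ + L / 2 * ‖y - x‖ ^ 2 := by
  set v := y - x with hv
  let h : ℝ → ℝ := fun t => f (x + t • v) - t * ⟪f' x, v⟫_ℝ - L / 2 * ‖v‖ ^ 2 * t ^ 2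
  have hd (t : ℝ) : HasDerivAt h
      (⟪f' (x + t • v), v⟫_ℝ - ⟪f' x, v⟫_ℝ - L * ‖v‖ ^ 2 * t) t := by
    have hline : HasDerivAt (fun t : ℝ => x + t • v) v t := by
      simpa using ((hasDerivAt_id t).smul_const v).const_add x
    have hf := (hgrad (x + t • v)).hasFDerivAt.comp_hasDerivAt t hline
    rw [InnerProductSpace.toDual_apply_apply] at hf
    have hl := (hasDerivAt_id t).mul_const ⟪f' x, v⟫_ℝ
    have hq := (hasDerivAt_pow 2 t).const_mul (L / 2 * ‖v‖ ^ 2)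
    refine ((hf.sub hl).sub hq).congr_deriv ?_
    norm_num
    ring
  have hanti : AntitoneOn h (Icc 0 1) := by
    refine antitoneOn_of_deriv_nonpos (convex_Icc 0 1)
      (fun t _ => (hd t).continuousAt.continuousWithinAt)
      (fun t _ => (hd t).differentiableAt.differentiableWithinAt) fun t ht => ?_
    rw [interior_Icc] at ht
    rw [(hd t).deriv, ← inner_sub_left]
    have hmem : x + t • v ∈ K := hK.add_smul_sub_mem hx hy ⟨ht.1.le, ht.2.le⟩
    have hb := hLip _ hmem x hx
    rw [add_sub_cancel_left, norm_smul, Real.norm_of_nonneg ht.1.le] at hb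
    have hcs := real_inner_le_norm (f' (x + t • v) - f' x) v
    nlinarith [mul_le_mul_of_nonneg_right hb (norm_nonneg v)]
  have h01 := hanti (left_mem_Icc.2 zero_le_one) (right_mem_Icc.2 zero_le_one) zero_le_one
  simp only [h, one_smul, zero_smul, add_zero] at h01
  rw [show x + v = y by rw [hv]; abel] at h01
  linarith

/-- A projected gradient step of length `1 / L` decreases the objective by at least
`L / 2` times the squared step. -/
lemma projected_gradient_step_descent [CompleteSpace E] {K : Set E} (hK : Convex ℝ K)
    {f : E → ℝ} {f' : E → E} {L : ℝ} (hL : 0 < L) (hgrad : ∀ x, HasGradientAt f (f' x) x)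
    (hLip : ∀ x ∈ K, ∀ y ∈ K, ‖f' x - f' y‖ ≤ L * ‖x - y‖)
    {x p : E} (hx : x ∈ K) (hp : p ∈ K)
    (hmin : ∀ w ∈ K, ‖x - (1 / L) • f' x - p‖ ≤ ‖x - (1 / L) • f' x - w‖) :
    f p ≤ f x - L / 2 * ‖x - p‖ ^ 2 := by
  have hproj := inner_sub_nearest_le_zero hK hp hmin hx
  rw [sub_right_comm, inner_sub_left, real_inner_smul_left, real_inner_self_eq_norm_sq] at hproj
  have hstep : L * ‖x - p‖ ^ 2 ≤ ⟪f' x, x - p⟫_ℝ := by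
    rw [sub_nonpos, one_div, inv_mul_eq_div, le_div_iff₀ hL] at hproj
    linarith
  have hq := le_quadratic_of_lipschitz_gradient hK hgrad hLip hx hp
  rw [← neg_sub x p, inner_neg_right, norm_neg] at hq
  linarith

end GradientDescent

/-- The global error bound implies quadratic functional growth with constant κ²/Lf = μ·κ
(Theorem 6 / `th_sog=eb`). Here g(x) = Lf(x - [x - (1/Lf)∇f(x)]_X) is the gradient mapping. -/
theorem error_bound_implies_quadratic_functional_growth
    {n : ℕ} (X Xstar : Set (EuclideanSpace ℝ (Fin n)))
    (f : EuclideanSpace ℝ (Fin n) → ℝ)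
    (f' proj projX : EuclideanSpace ℝ (Fin n) → EuclideanSpace ℝ (Fin n))
    (fstar Lf : ℝ)
    -- X is a nonempty closed convex set
    (hXne : X.Nonempty) (hXclosed : IsClosed X) (hXconv : Convex ℝ X)
    -- f is convex and continuously differentiable, with gradient f'
    (hconv : ConvexOn ℝ univ f)
    (hsmooth : ContDiff ℝ 1 f)
    (hgrad : ∀ x, HasGradientAt f (f' x) x)
    -- the gradient of f is Lipschitz continuous on X with constant Lf > 0
    (hLf : 0 < Lf)
    (hLip : ∀ x ∈ X, ∀ y ∈ X, ‖f' x - f' y‖ ≤ Lf * ‖x - y‖)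
    -- Xstar is the (nonempty, closed) set of minimizers of f over X, with optimal value fstar
    (hXstar : Xstar = {x ∈ X | ∀ y ∈ X, f x ≤ f y})
    (hXstar_ne : Xstar.Nonempty) (hXstar_closed : IsClosed Xstar)
    (hfstar : ∀ x ∈ Xstar, f x = fstar)
    -- proj is the Euclidean projection onto Xstar
    (hproj : ∀ x, proj x ∈ Xstar ∧ ∀ y ∈ Xstar, ‖x - proj x‖ ≤ ‖x - y‖)
    -- projX is the Euclidean projection onto X
    (hprojX : ∀ u, projX u ∈ X ∧ ∀ y ∈ X, ‖u - projX u‖ ≤ ‖u - y‖)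
    -- f satisfies the global error bound on X with constant κ > 0
    (κ : ℝ) (hκ : 0 < κ)
    (heb : ∀ x ∈ X, ‖Lf • (x - projX (x - (1 / Lf) • f' x))‖ ≥ κ * ‖x - proj x‖) :
    -- conclusion: quadratic functional growth with constant κ²/Lf
    ∀ x ∈ X, f x - fstar ≥ κ ^ 2 / Lf / 2 * ‖x - proj x‖ ^ 2 := by
  intro x hx
  obtain ⟨hp, hmin⟩ := hprojX (x - (1 / Lf) • f' x)
  set p := projX (x - (1 / Lf) • f' x)
  have hdesc := projected_gradient_step_descent hXconv hLf hgrad hLip hx hp hmin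
  obtain ⟨z, hz⟩ := hXstar_ne
  have hlow : fstar ≤ f p := by
    rw [← hfstar z hz]
    rw [hXstar] at hz
    exact hz.2 p hp
  have hbound : κ * ‖x - proj x‖ ≤ Lf * ‖x - p‖ := by
    simpa only [norm_smul, Real.norm_of_nonneg hLf.le] using heb x hx
  have hsq : (κ * ‖x - proj x‖) ^ 2 ≤ (Lf * ‖x - p‖) ^ 2 := by gcongr
  calc κ ^ 2 / Lf / 2 * ‖x - proj x‖ ^ 2 = (κ * ‖x - proj x‖) ^ 2 / (2 * Lf) := by
        field_simp
    _ ≤ (Lf * ‖x - p‖) ^ 2 / (2 * Lf) := by gcongr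
    _ = Lf / 2 * ‖x - p‖ ^ 2 := by field_simp
    _ ≤ f x - fstar := by linarith
end

section
/- Let f be a convex function with L_f-Lipschitz continuous gradient that satisfies the quadratic functional growth condition on X with constant κ_f > 0. Then f satisfies the global error bound on X with constant κ_f/(1 + μ_f + √(1 + μ_f)), where μ_f = κ_f/L_f, i.e., ‖g(x)‖ ≥ (κ_f/(1 + μ_f + √(1 + μ_f)))‖x − x̄‖ for all x ∈ X. -/
open Set
open scoped InnerProductSpace

/-- The derivative of a differentiable function along a line. -/
lemma HasGradientAt.hasDerivAt_comp_add_smul {E : Type*} [NormedAddCommGroup E]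
    [InnerProductSpace ℝ E] [CompleteSpace E] {f : E → ℝ} {g x v : E} {t : ℝ}
    (h : HasGradientAt f g (x + t • v)) :
    HasDerivAt (fun s : ℝ => f (x + s • v)) ⟪g, v⟫_ℝ t := by
  have hline : HasDerivAt (fun s : ℝ => x + s • v) v t := by
    simpa using ((hasDerivAt_id t).smul_const v).const_add x
  have hcomp := h.hasFDerivAt.comp_hasDerivAt t hline
  rw [InnerProductSpace.toDual_apply_apply] at hcomp
  exact hcomp

/-- The first-order characterization of convexity. -/
lemma ConvexOn.add_inner_gradient_le {E : Type*} [NormedAddCommGroup E]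
    [InnerProductSpace ℝ E] [CompleteSpace E] {f : E → ℝ} {g x : E}
    (hf : ConvexOn ℝ univ f) (h : HasGradientAt f g x) (y : E) :
    f x + ⟪g, y - x⟫_ℝ ≤ f y := by
  have hd : HasDerivAt (fun s : ℝ => f (x + s • (y - x))) ⟪g, y - x⟫_ℝ 0 :=
    HasGradientAt.hasDerivAt_comp_add_smul (by simpa using h)
  have hc : ConvexOn ℝ univ (fun s : ℝ => f (x + s • (y - x))) := by
    have := hf.comp_affineMap (AffineMap.lineMap (k := ℝ) x y)
    simpa [Function.comp_def, AffineMap.lineMap_apply, add_comm] using this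
  have := hc.le_slope_of_hasDerivAt (mem_univ 0) (mem_univ 1) one_pos hd
  simp [slope_def_field] at this
  linarith

/-- The descent lemma for a gradient that is Lipschitz continuous on a convex set. -/
lemma le_add_inner_add_of_gradient_lipschitzOn {E : Type*} [NormedAddCommGroup E]
    [InnerProductSpace ℝ E] [CompleteSpace E] {f : E → ℝ} {f' : E → E} {X : Set E} {L : ℝ}
    (hX : Convex ℝ X) (hgrad : ∀ x, HasGradientAt f (f' x) x)
    (hLip : ∀ x ∈ X, ∀ y ∈ X, ‖f' x - f' y‖ ≤ L * ‖x - y‖)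
    {x y : E} (hx : x ∈ X) (hy : y ∈ X) :
    f y ≤ f x + ⟪f' x, y - x⟫_ℝ + L / 2 * ‖y - x‖ ^ 2 := by
  set v := y - x with hv
  have hd : ∀ t : ℝ, HasDerivAt
      (fun s : ℝ => f (x + s • v) - (s * ⟪f' x, v⟫_ℝ + s ^ 2 * (L / 2 * ‖v‖ ^ 2)))
      (⟪f' (x + t • v), v⟫_ℝ - (⟪f' x, v⟫_ℝ + 2 * t * (L / 2 * ‖v‖ ^ 2))) t := by
    intro t
    have hquad : HasDerivAt (fun s : ℝ => s * ⟪f' x, v⟫_ℝ + s ^ 2 * (L / 2 * ‖v‖ ^ 2))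
        (⟪f' x, v⟫_ℝ + 2 * t * (L / 2 * ‖v‖ ^ 2)) t := by
      have hsum := ((hasDerivAt_id t).mul_const ⟪f' x, v⟫_ℝ).add
        ((hasDerivAt_pow 2 t).mul_const (L / 2 * ‖v‖ ^ 2))
      exact hsum.congr_deriv (by simp)
    exact (hgrad _).hasDerivAt_comp_add_smul.sub hquad
  have hanti := antitoneOn_of_deriv_nonpos (convex_Icc (0 : ℝ) 1)
    (fun t _ => (hd t).continuousAt.continuousWithinAt)
    (fun t _ => (hd t).differentiableAt.differentiableWithinAt) (by
      intro t ht
      rw [interior_Icc] at ht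
      rw [(hd t).deriv]
      have hmem : x + t • v ∈ X := hX.add_smul_sub_mem hx hy ⟨ht.1.le, ht.2.le⟩
      have hlip := hLip _ hmem x hx
      rw [add_sub_cancel_left, norm_smul, Real.norm_of_nonneg ht.1.le] at hlip
      have hcs := real_inner_le_norm (f' (x + t • v) - f' x) v
      rw [inner_sub_left] at hcs
      nlinarith [mul_le_mul_of_nonneg_right hlip (norm_nonneg v)])
  have h01 := hanti (left_mem_Icc.2 zero_le_one) (right_mem_Icc.2 zero_le_one) zero_le_one
  simp [hv] at h01
  rw [hv]
  linarith

/-- The variational inequality for a nearest point of a convex set. -/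
lemma Convex.inner_sub_le_zero_of_forall_norm_le {E : Type*} [NormedAddCommGroup E]
    [InnerProductSpace ℝ E] {X : Set E} (hX : Convex ℝ X) {u p y : E} (hp : p ∈ X)
    (hmin : ∀ z ∈ X, ‖u - p‖ ≤ ‖u - z‖) (hy : y ∈ X) : ⟪u - p, y - p⟫_ℝ ≤ 0 := by
  have : Nonempty X := ⟨⟨p, hp⟩⟩
  refine (norm_eq_iInf_iff_real_inner_le_zero hX hp).1 (le_antisymm ?_ ?_) y hy
  · exact le_ciInf fun z => hmin z z.2
  · exact ciInf_le ⟨0, by rintro _ ⟨z, rfl⟩; exact norm_nonneg _⟩ (⟨p, hp⟩ : X)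

/-- Bound on the larger root of a quadratic inequality. -/
lemma mul_le_of_quadratic_le {κ L d G : ℝ} (hκ : 0 < κ) (hL : 0 < L) (hG : 0 ≤ G)
    (h : κ / 2 * d ^ 2 ≤ G * d + G ^ 2 / (2 * L)) :
    κ * d ≤ (1 + √(1 + κ / L)) * G := by
  have hs : √(1 + κ / L) ^ 2 = 1 + κ / L := Real.sq_sqrt (by positivity)
  have hsq : (κ * d - G) ^ 2 ≤ (√(1 + κ / L) * G) ^ 2 := by
    have h2 : 2 * κ * (κ / 2 * d ^ 2) ≤ 2 * κ * (G * d + G ^ 2 / (2 * L)) := by gcongr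
    have h3 : 2 * κ * (G * d + G ^ 2 / (2 * L)) = 2 * κ * G * d + κ / L * G ^ 2 := by
      field_simp
    rw [mul_pow, hs]
    linarith
  linarith [(abs_le_of_sq_le_sq' hsq (by positivity)).2]

/-- Quadratic functional growth implies the global error bound with constant
κ/(1 + μ + √(1 + μ)), where μ = κ/Lf (Theorem 7 / `th_eb=sog`).
Here g(x) = Lf(x - [x - (1/Lf)∇f(x)]_X) is the gradient mapping. -/
theorem quadratic_functional_growth_implies_error_bound
    {n : ℕ} (X Xstar : Set (EuclideanSpace ℝ (Fin n)))
    (f : EuclideanSpace ℝ (Fin n) → ℝ)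
    (f' proj projX : EuclideanSpace ℝ (Fin n) → EuclideanSpace ℝ (Fin n))
    (fstar Lf : ℝ)
    -- X is a nonempty closed convex set
    (hXne : X.Nonempty) (hXclosed : IsClosed X) (hXconv : Convex ℝ X)
    -- f is convex and continuously differentiable, with gradient f'
    (hconv : ConvexOn ℝ univ f)
    (hsmooth : ContDiff ℝ 1 f)
    (hgrad : ∀ x, HasGradientAt f (f' x) x)
    -- the gradient of f is Lipschitz continuous on X with constant Lf > 0
    (hLf : 0 < Lf)
    (hLip : ∀ x ∈ X, ∀ y ∈ X, ‖f' x - f' y‖ ≤ Lf * ‖x - y‖)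
    -- Xstar is the (nonempty, closed) set of minimizers of f over X, with optimal value fstar
    (hXstar : Xstar = {x ∈ X | ∀ y ∈ X, f x ≤ f y})
    (hXstar_ne : Xstar.Nonempty) (hXstar_closed : IsClosed Xstar)
    (hfstar : ∀ x ∈ Xstar, f x = fstar)
    -- proj is the Euclidean projection onto Xstar
    (hproj : ∀ x, proj x ∈ Xstar ∧ ∀ y ∈ Xstar, ‖x - proj x‖ ≤ ‖x - y‖)
    -- projX is the Euclidean projection onto X
    (hprojX : ∀ u, projX u ∈ X ∧ ∀ y ∈ X, ‖u - projX u‖ ≤ ‖u - y‖)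
    -- f satisfies the quadratic functional growth on X with constant κ > 0
    (κ : ℝ) (hκ : 0 < κ)
    (hqfg : ∀ x ∈ X, f x - fstar ≥ κ / 2 * ‖x - proj x‖ ^ 2) :
    -- conclusion: global error bound with constant κ/(1 + μ + √(1 + μ)), μ = κ/Lf
    ∀ x ∈ X, ‖Lf • (x - projX (x - (1 / Lf) • f' x))‖ ≥
      κ / (1 + κ / Lf + Real.sqrt (1 + κ / Lf)) * ‖x - proj x‖ := by
  intro x hx
  set p := projX (x - (1 / Lf) • f' x) with hp
  set g := Lf • (x - p) with hg
  obtain ⟨hpX, hpmin⟩ := hprojX (x - (1 / Lf) • f' x)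
  obtain ⟨hqS, -⟩ := hproj p
  set q := proj p with hq
  have hqX : q ∈ X := by
    rw [hXstar] at hqS
    exact hqS.1
  have hxp : x - p = (1 / Lf) • g := by
    rw [hg, smul_smul, one_div_mul_cancel hLf.ne', one_smul]
  have hnorm : ‖x - p‖ = ‖g‖ / Lf := by
    rw [hxp, norm_smul, Real.norm_of_nonneg (by positivity)]
    ring
  have hvar : ⟪g, q - p⟫_ℝ ≤ ⟪f' x, q - p⟫_ℝ := by
    have h := hXconv.inner_sub_le_zero_of_forall_norm_le hpX hpmin hqX
    rw [← hp, sub_right_comm, hxp, ← smul_sub, real_inner_smul_left, inner_sub_left] at h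
    have := nonpos_of_mul_nonpos_right h (by positivity)
    linarith
  have hlow := hconv.add_inner_gradient_le (hgrad x) q
  have hup := le_add_inner_add_of_gradient_lipschitzOn hXconv hgrad hLip hx hpX
  have hsplit : ⟪f' x, q - x⟫_ℝ = ⟪f' x, q - p⟫_ℝ + ⟪f' x, p - x⟫_ℝ := by
    rw [← inner_add_right, sub_add_sub_cancel]
  have hcs : -⟪g, q - p⟫_ℝ ≤ ‖g‖ * ‖p - q‖ := by
    rw [← inner_neg_right, neg_sub]
    exact real_inner_le_norm g (p - q)
  have hgap : κ / 2 * ‖p - q‖ ^ 2 ≤ ‖g‖ * ‖p - q‖ + ‖g‖ ^ 2 / (2 * Lf) := by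
    have hgrowth := hqfg p hpX
    rw [← hfstar q hqS] at hgrowth
    rw [norm_sub_rev p x, hnorm] at hup
    have : Lf / 2 * (‖g‖ / Lf) ^ 2 = ‖g‖ ^ 2 / (2 * Lf) := by field_simp
    linarith
  have hd := mul_le_of_quadratic_le hκ hLf (norm_nonneg g) hgap
  have hdist : ‖x - proj x‖ ≤ ‖g‖ / Lf + ‖p - q‖ := by
    rw [← hnorm]
    exact ((hproj x).2 q hqS).trans (norm_sub_le_norm_sub_add_norm_sub x p q)
  rw [ge_iff_le, div_mul_eq_mul_div, div_le_iff₀ (by positivity)]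
  calc κ * ‖x - proj x‖ ≤ κ * (‖g‖ / Lf + ‖p - q‖) := by gcongr
    _ = κ / Lf * ‖g‖ + κ * ‖p - q‖ := by ring
    _ ≤ κ / Lf * ‖g‖ + (1 + √(1 + κ / Lf)) * ‖g‖ := by gcongr
    _ = ‖g‖ * (1 + κ / Lf + √(1 + κ / Lf)) := by ring
end

section
/- Let X ⊆ ℝ^n be a nonempty closed convex set, A ∈ ℝ^{m×n} a nonzero matrix, c ∈ ℝ^n, and g : ℝ^m → ℝ a σ_g-strongly convex function with L_g-Lipschitz continuous gradient. Set f(x) = g(Ax) + ⟨c, x⟩, assume f attains its minimum f* on X with nonempty closed optimal set X*, and let c_g = ‖∇g(Ax*)‖ for x* ∈ X* (which is independent of the choice of x*). Suppose θ > 0 satisfies ‖x − x̄‖² ≤ θ²(‖Ax − Ax̄‖² + ⟨c, x − x̄⟩²) for all x ∈ X, where x̄ = [x]_{X*}. Then for any M > 0, f has quadratic functional growth on the sublevel set X_M = {x ∈ X : f(x) − f* ≤ M} with constant κ_f = σ_g/(θ²(1 + Mσ_g + 2c_g²)), i.e., f(x) − f* ≥ (κ_f/2)‖x − x̄‖² for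 all x ∈ X with f(x) − f* ≤ M. -/
open Set
open scoped InnerProductSpace

section

variable {E F : Type*} [NormedAddCommGroup E] [InnerProductSpace ℝ E]
  [NormedAddCommGroup F] [InnerProductSpace ℝ F] [CompleteSpace F]

/-- A function with strongly monotone gradient satisfies the strong convexity lower bound. -/
theorem add_inner_add_sq_le_of_strongly_monotone_gradient {g : F → ℝ} {g' : F → F} {σ : ℝ}
    (hg : ∀ u, HasGradientAt g (g' u) u)
    (hσ : ∀ u v, ⟪g' u - g' v, u - v⟫_ℝ ≥ σ * ‖u - v‖ ^ 2) (u v : F) :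
    g u + ⟪g' u, v - u⟫_ℝ + σ / 2 * ‖v - u‖ ^ 2 ≤ g v := by
  set w := v - u with hw
  let φ : ℝ → ℝ := fun t => g (u + t • w) - t * ⟪g' u, w⟫_ℝ - σ / 2 * ‖w‖ ^ 2 * t ^ 2
  have hφ : ∀ t, HasDerivAt φ
      (⟪g' (u + t • w), w⟫_ℝ - ⟪g' u, w⟫_ℝ - σ * ‖w‖ ^ 2 * t) t := by
    intro t
    have hline : HasDerivAt (fun t : ℝ => u + t • w) w t := by
      simpa using ((hasDerivAt_id t).smul_const w).const_add u
    have hcomp : HasDerivAt (fun t : ℝ => g (u + t • w)) ⟪g' (u + t • w), w⟫_ℝ t := by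
      exact ((hg (u + t • w)).hasFDerivAt.comp_hasDerivAt t hline).congr_deriv (by simp)
    refine ((hcomp.sub ((hasDerivAt_id t).mul_const ⟪g' u, w⟫_ℝ)).sub
      (((hasDerivAt_id t).pow 2).const_mul (σ / 2 * ‖w‖ ^ 2))).congr_deriv ?_
    simp
    ring
  have hmono : MonotoneOn φ (Icc 0 1) := by
    refine monotoneOn_of_deriv_nonneg (convex_Icc 0 1)
      (fun t _ => (hφ t).continuousAt.continuousWithinAt)
      (fun t _ => (hφ t).differentiableAt.differentiableWithinAt) fun t ht => ?_
    rw [interior_Icc] at ht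
    have h := hσ (u + t • w) u
    rw [add_sub_cancel_left, inner_smul_right, norm_smul, Real.norm_eq_abs, mul_pow, sq_abs,
      inner_sub_left] at h
    rw [(hφ t).deriv]
    have ht0 : 0 < t := ht.1
    refine nonneg_of_mul_nonneg_right (a := t) ?_ ht0
    linarith
  have h := hmono (left_mem_Icc.2 zero_le_one) (right_mem_Icc.2 zero_le_one) zero_le_one
  simp only [φ, zero_smul, one_smul, add_zero, hw, add_sub_cancel] at h
  rw [hw]
  linarith

/-- First-order optimality of a minimizer over a convex set. -/
theorem IsMinOn.inner_gradient_comp_add_nonneg {X : Set E} (hX : Convex ℝ X) {A : E →L[ℝ] F}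
    {c y x : E} {g : F → ℝ} {G : F} (hg : HasGradientAt g G (A y))
    (hmin : IsMinOn (fun z => g (A z) + ⟪c, z⟫_ℝ) X y) (hy : y ∈ X) (hx : x ∈ X) :
    0 ≤ ⟪G, A x - A y⟫_ℝ + ⟪c, x - y⟫_ℝ := by
  have hd := (hg.hasFDerivAt.comp y A.hasFDerivAt).add (innerSL ℝ c).hasFDerivAt
  have h := hmin.localize.hasFDerivWithinAt_nonneg (f := fun z => g (A z) + ⟪c, z⟫_ℝ)
    hd.hasFDerivWithinAt
    (sub_mem_posTangentConeAt_of_segment_subset (hX.segment_subset hy hx))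
  simpa using h

end

/-- Composition of a strongly convex smooth function with a linear map plus a linear term
has quadratic functional growth on sublevel sets, with constant σg/(θ²(1 + Mσg + 2c_g²))
(Theorem 10 / `the_gAx_cx`). -/
theorem composition_plus_linear_quadratic_functional_growth_on_sublevel
    {n m : ℕ} (X Xstar : Set (EuclideanSpace ℝ (Fin n)))
    (A : EuclideanSpace ℝ (Fin n) →L[ℝ] EuclideanSpace ℝ (Fin m))
    (c : EuclideanSpace ℝ (Fin n))
    (g : EuclideanSpace ℝ (Fin m) → ℝ)
    (g' : EuclideanSpace ℝ (Fin m) → EuclideanSpace ℝ (Fin m))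
    (f : EuclideanSpace ℝ (Fin n) → ℝ)
    (f' proj : EuclideanSpace ℝ (Fin n) → EuclideanSpace ℝ (Fin n))
    (xstar : EuclideanSpace ℝ (Fin n))
    (fstar σg Lg θ cg : ℝ)
    -- X is a nonempty closed convex set, A is a nonzero matrix
    (hXne : X.Nonempty) (hXclosed : IsClosed X) (hXconv : Convex ℝ X)
    (hA : A ≠ 0)
    -- g is σg-strongly convex with Lg-Lipschitz continuous gradient g'
    (hσg : 0 < σg) (hLg : 0 < Lg)
    (hggrad : ∀ u, HasGradientAt g (g' u) u)
    (hgsc : ∀ u v, ⟪g' u - g' v, u - v⟫_ℝ ≥ σg * ‖u - v‖ ^ 2)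
    (hgLip : ∀ u v, ‖g' u - g' v‖ ≤ Lg * ‖u - v‖)
    -- f(x) = g(Ax) + ⟨c, x⟩, with gradient f'
    (hf : ∀ x, f x = g (A x) + ⟪c, x⟫_ℝ)
    (hfgrad : ∀ x, HasGradientAt f (f' x) x)
    -- Xstar is the (nonempty, closed) set of minimizers of f over X, with optimal value fstar
    (hXstar : Xstar = {x ∈ X | ∀ y ∈ X, f x ≤ f y})
    (hXstar_ne : Xstar.Nonempty) (hXstar_closed : IsClosed Xstar)
    (hfstar : ∀ x ∈ Xstar, f x = fstar)
    -- cg = ‖∇g(Ax*)‖ for some (any) x* ∈ Xstar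
    (hxstar : xstar ∈ Xstar) (hcg : cg = ‖g' (A xstar)‖)
    -- proj is the Euclidean projection onto Xstar
    (hproj : ∀ x, proj x ∈ Xstar ∧ ∀ y ∈ Xstar, ‖x - proj x‖ ≤ ‖x - y‖)
    -- Hoffman inequality for the optimal set with constant θ > 0
    (hθ : 0 < θ)
    (hHoffman : ∀ x ∈ X,
      ‖x - proj x‖ ^ 2 ≤ θ ^ 2 * (‖A x - A (proj x)‖ ^ 2 + ⟪c, x - proj x⟫_ℝ ^ 2)) :
    -- conclusion: quadratic functional growth on every sublevel set X_M
    ∀ M > (0:ℝ), ∀ x ∈ X, f x - fstar ≤ M →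
      f x - fstar ≥ σg / (θ ^ 2 * (1 + M * σg + 2 * cg ^ 2)) / 2 * ‖x - proj x‖ ^ 2 := by
  intro M hM x hx hxM
  have hopt : ∀ y ∈ Xstar, y ∈ X ∧ ∀ z ∈ X, f y ≤ f z := by
    intro y hy
    rwa [hXstar] at hy
  have hfirst : ∀ y ∈ Xstar, ∀ z ∈ X, 0 ≤ ⟪g' (A y), A z - A y⟫_ℝ + ⟪c, z - y⟫_ℝ := by
    intro y hy z hz
    refine IsMinOn.inner_gradient_comp_add_nonneg hXconv (hggrad (A y)) ?_ (hopt y hy).1 hz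
    intro w hw
    simpa only [mem_ofPred_eq, ← hf] using (hopt y hy).2 w hw
  have hgrowth : ∀ y ∈ Xstar, ∀ z : EuclideanSpace ℝ (Fin n),
      ⟪g' (A y), A z - A y⟫_ℝ + ⟪c, z - y⟫_ℝ + σg / 2 * ‖A z - A y‖ ^ 2 ≤ f z - fstar := by
    intro y hy z
    have h := add_inner_add_sq_le_of_strongly_monotone_gradient hggrad hgsc (A y) (A z)
    rw [← hfstar y hy, hf z, hf y, inner_sub_right c]
    linarith
  obtain ⟨hp, -⟩ := hproj x
  have hAeq : A (proj x) = A xstar := by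
    have h1 := hfirst xstar hxstar (proj x) (hopt _ hp).1
    have h2 := hgrowth xstar hxstar (proj x)
    rw [hfstar _ hp, sub_self] at h2
    have h3 : ‖A (proj x) - A xstar‖ ^ 2 ≤ 0 :=
      nonpos_of_mul_nonpos_right (by linarith) (half_pos hσg)
    rwa [sq_nonpos_iff, norm_eq_zero, sub_eq_zero] at h3
  have hfo := hfirst _ hp x hx
  have hgr := hgrowth _ hp x
  have hHo := hHoffman x hx
  have hcs := abs_real_inner_le_norm (g' (A (proj x))) (A x - A (proj x))
  have hcg' : ‖g' (A (proj x))‖ = cg := by rw [hAeq, hcg]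
  rw [hcg'] at hcs
  set D := f x - fstar
  set d := ‖A x - A (proj x)‖
  set s := ⟪c, x - proj x⟫_ℝ
  set p := ⟪g' (A (proj x)), A x - A (proj x)⟫_ℝ
  have hp2 : p ^ 2 ≤ cg ^ 2 * d ^ 2 := by
    rw [← mul_pow, ← sq_abs p]
    exact pow_le_pow_left₀ (abs_nonneg p) hcs 2
  have hd : σg * d ^ 2 ≤ 2 * D := by linarith
  have hq : (p + s) ^ 2 ≤ M * D := by
    have hqD : p + s ≤ D := by
      have : 0 ≤ σg / 2 * d ^ 2 := by positivity
      linarith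
    rw [sq]
    exact mul_le_mul (hqD.trans hxM) hqD hfo hM.le
  have hs : s ^ 2 ≤ 2 * (p + s) ^ 2 + 2 * p ^ 2 := by nlinarith [sq_nonneg (2 * p + s)]
  have hkey : σg * (d ^ 2 + s ^ 2) ≤ 2 * (1 + M * σg + 2 * cg ^ 2) * D := by
    have h1 := mul_le_mul_of_nonneg_left
      (show s ^ 2 ≤ 2 * (M * D) + 2 * (cg ^ 2 * d ^ 2) by linarith) hσg.le
    have h2 := mul_le_mul_of_nonneg_left hd (sq_nonneg cg)
    linarith
  have hK : 0 < 1 + M * σg + 2 * cg ^ 2 := by positivity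
  rw [ge_iff_le, div_div, div_mul_eq_mul_div, div_le_iff₀ (by positivity)]
  calc σg * ‖x - proj x‖ ^ 2 ≤ σg * (θ ^ 2 * (d ^ 2 + s ^ 2)) := by gcongr
    _ = θ ^ 2 * (σg * (d ^ 2 + s ^ 2)) := by ring
    _ ≤ θ ^ 2 * (2 * (1 + M * σg + 2 * cg ^ 2) * D) := by gcongr
    _ = D * (θ ^ 2 * (1 + M * σg + 2 * cg ^ 2) * 2) := by ring
end

section
/- Let f be convex with L_f-Lipschitz continuous gradient on X and satisfy the quadratic functional growth condition on X with constant κ_f > 0, and let μ_f = κ_f/L_f. The projected gradient iterates x^{k+1} = [x^k − (1/L_f)∇f(x^k)]_X, started from x^0 ∈ X, satisfy ‖x^k − [x^k]_{X*}‖² ≤ (1/(1 + μ_f))^k·‖x^0 − [x^0]_{X*}‖² for all k ≥ 0. -/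
open Set
open scoped InnerProductSpace

/-- First-order lower bound of a convex function by its gradient. -/
lemma ConvexOn.add_inner_le_of_hasGradientAt
    {E : Type*} [NormedAddCommGroup E] [InnerProductSpace ℝ E] [CompleteSpace E]
    {f : E → ℝ} {g x : E} (hf : ConvexOn ℝ univ f) (hg : HasGradientAt f g x) (y : E) :
    f x + ⟪g, y - x⟫_ℝ ≤ f y := by
  have hline : HasDerivAt (fun t : ℝ => AffineMap.lineMap x y t) (y - x) 0 :=
    AffineMap.hasDerivAt_lineMap
  have hd : HasDerivAt (fun t : ℝ => f (AffineMap.lineMap x y t)) ⟪g, y - x⟫_ℝ 0 := by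
    have hg' : HasFDerivAt f (InnerProductSpace.toDual ℝ E g)
        (AffineMap.lineMap x y (0 : ℝ)) := by
      simpa using hg.hasFDerivAt
    exact (hg'.comp_hasDerivAt (0 : ℝ) hline).congr_deriv (by simp)
  have hc : ConvexOn ℝ univ (fun t : ℝ => f (AffineMap.lineMap x y t)) :=
    hf.comp_affineMap (AffineMap.lineMap x y)
  have h := hc.le_slope_of_hasDerivAt (mem_univ 0) (mem_univ 1) zero_lt_one hd
  simp [slope_def_field] at h
  linarith

/-- The descent lemma along a segment: a Lipschitz gradient gives a quadratic upper bound. -/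
lemma Convex.le_add_inner_add_of_lipschitz_gradient
    {E : Type*} [NormedAddCommGroup E] [InnerProductSpace ℝ E] [CompleteSpace E]
    {X : Set E} {f : E → ℝ} {f' : E → E} {L : ℝ} (hX : Convex ℝ X)
    (hgrad : ∀ x, HasGradientAt f (f' x) x)
    (hLip : ∀ x ∈ X, ∀ y ∈ X, ‖f' x - f' y‖ ≤ L * ‖x - y‖)
    {x y : E} (hx : x ∈ X) (hy : y ∈ X) :
    f y ≤ f x + ⟪f' x, y - x⟫_ℝ + L / 2 * ‖y - x‖ ^ 2 := by
  have hd (t : ℝ) : HasDerivAt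
      (fun t : ℝ => f (AffineMap.lineMap x y t) - (t * ⟪f' x, y - x⟫_ℝ
        + t ^ 2 * (L / 2 * ‖y - x‖ ^ 2)))
      (⟪f' (AffineMap.lineMap x y t), y - x⟫_ℝ - (⟪f' x, y - x⟫_ℝ
        + 2 * t * (L / 2 * ‖y - x‖ ^ 2))) t := by
    have hline : HasDerivAt (fun t : ℝ => AffineMap.lineMap x y t) (y - x) t :=
      AffineMap.hasDerivAt_lineMap
    have h₁ := (hgrad (AffineMap.lineMap x y t)).hasFDerivAt.comp_hasDerivAt t hline
    have h₂ := (hasDerivAt_id t).mul_const ⟪f' x, y - x⟫_ℝ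
    have h₃ := (hasDerivAt_pow 2 t).mul_const (L / 2 * ‖y - x‖ ^ 2)
    exact (h₁.sub (h₂.add h₃)).congr_deriv (by simp)
  have hanti := antitoneOn_of_deriv_nonpos (convex_Icc (0 : ℝ) 1)
    (fun t _ => (hd t).continuousAt.continuousWithinAt)
    (fun t _ => (hd t).differentiableAt.differentiableWithinAt)
    (fun t ht => by
      rw [interior_Icc] at ht
      rw [(hd t).deriv]
      have hmem : AffineMap.lineMap x y t ∈ X := hX.lineMap_mem hx hy ⟨ht.1.le, ht.2.le⟩
      have hnorm : ‖AffineMap.lineMap x y t - x‖ = t * ‖y - x‖ := by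
        simp [AffineMap.lineMap_apply, norm_smul, abs_of_pos ht.1]
      have hl := hLip _ hmem x hx
      rw [hnorm] at hl
      have hi := real_inner_le_norm (f' (AffineMap.lineMap x y t) - f' x) (y - x)
      rw [inner_sub_left] at hi
      nlinarith [mul_le_mul_of_nonneg_right hl (norm_nonneg (y - x))])
  have h := hanti (left_mem_Icc.2 zero_le_one) (right_mem_Icc.2 zero_le_one) zero_le_one
  simp at h
  linarith

/-- Comparison of a projected gradient step with a feasible point. -/
lemma norm_sq_projected_gradient_step_le
    {E : Type*} [NormedAddCommGroup E] [InnerProductSpace ℝ E] [CompleteSpace E]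
    {X : Set E} {f : E → ℝ} {f' : E → E} {L : ℝ} (hX : Convex ℝ X)
    (hf : ConvexOn ℝ univ f) (hgrad : ∀ x, HasGradientAt f (f' x) x) (hL : 0 < L)
    (hLip : ∀ x ∈ X, ∀ y ∈ X, ‖f' x - f' y‖ ≤ L * ‖x - y‖)
    {x y z : E} (hx : x ∈ X) (hy : y ∈ X) (hz : z ∈ X)
    (hproj : ∀ w ∈ X, ‖x - (1 / L) • f' x - y‖ ≤ ‖x - (1 / L) • f' x - w‖) :
    ‖y - z‖ ^ 2 + 2 / L * (f y - f z) ≤ ‖x - z‖ ^ 2 := by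
  have hlow := hf.add_inner_le_of_hasGradientAt (hgrad x) z
  have hup := hX.le_add_inner_add_of_lipschitz_gradient hgrad hLip hx hy
  have hvar : ⟪x - (1 / L) • f' x - y, z - y⟫_ℝ ≤ 0 := by
    have : Nonempty X := ⟨⟨y, hy⟩⟩
    refine (norm_eq_iInf_iff_real_inner_le_zero hX hy).1 (le_antisymm ?_ ?_) z hz
    · exact le_ciInf fun w => hproj w w.2
    · exact ciInf_le (f := fun w : X => ‖x - (1 / L) • f' x - w‖)
        ⟨0, by rintro _ ⟨w, rfl⟩; exact norm_nonneg _⟩ ⟨y, hy⟩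
  have hsplit : ⟪x - (1 / L) • f' x - y, z - y⟫_ℝ
      = ⟪x - y, z - y⟫_ℝ - 1 / L * (⟪f' x, z - x⟫_ℝ - ⟪f' x, y - x⟫_ℝ) := by
    rw [← inner_sub_right, sub_sub_sub_cancel_right, ← real_inner_smul_left, ← inner_sub_left,
      sub_right_comm]
  have hcos : ‖x - z‖ ^ 2 = ‖x - y‖ ^ 2 - 2 * ⟪x - y, z - y⟫_ℝ + ‖y - z‖ ^ 2 := by
    rw [norm_sub_rev y z, ← norm_sub_sq_real, sub_sub_sub_cancel_right]
  have hgap : 2 / L * (f y - f z) ≤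
      2 / L * (⟪f' x, y - x⟫_ℝ - ⟪f' x, z - x⟫_ℝ + L / 2 * ‖y - x‖ ^ 2) := by
    gcongr
    linarith
  have hexp : 2 / L * (⟪f' x, y - x⟫_ℝ - ⟪f' x, z - x⟫_ℝ + L / 2 * ‖y - x‖ ^ 2)
      = -2 * (1 / L * (⟪f' x, z - x⟫_ℝ - ⟪f' x, y - x⟫_ℝ)) + ‖x - y‖ ^ 2 := by
    rw [norm_sub_rev y x]
    field_simp
    ring
  linarith

/-- Linear convergence of the projected gradient method under quadratic functional growth
(Theorem 12 / `th_gm_S`): ‖xᵏ - x̄ᵏ‖² ≤ (1/(1+μ))ᵏ ‖x⁰ - x̄⁰‖² with μ = κ/Lf. -/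
theorem gm_linear_convergence_quadratic_functional_growth
    {n : ℕ} (X Xstar : Set (EuclideanSpace ℝ (Fin n)))
    (f : EuclideanSpace ℝ (Fin n) → ℝ)
    (f' proj projX : EuclideanSpace ℝ (Fin n) → EuclideanSpace ℝ (Fin n))
    (fstar Lf κ : ℝ)
    -- X is a nonempty closed convex set
    (hXne : X.Nonempty) (hXclosed : IsClosed X) (hXconv : Convex ℝ X)
    -- f is convex and continuously differentiable, with gradient f'
    (hconv : ConvexOn ℝ univ f)
    (hsmooth : ContDiff ℝ 1 f)
    (hgrad : ∀ x, HasGradientAt f (f' x) x)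
    -- the gradient of f is Lipschitz continuous on X with constant Lf > 0
    (hLf : 0 < Lf)
    (hLip : ∀ x ∈ X, ∀ y ∈ X, ‖f' x - f' y‖ ≤ Lf * ‖x - y‖)
    -- Xstar is the (nonempty, closed) set of minimizers of f over X, with optimal value fstar
    (hXstar : Xstar = {x ∈ X | ∀ y ∈ X, f x ≤ f y})
    (hXstar_ne : Xstar.Nonempty) (hXstar_closed : IsClosed Xstar)
    (hfstar : ∀ x ∈ Xstar, f x = fstar)
    -- proj is the Euclidean projection onto Xstar
    (hproj : ∀ x, proj x ∈ Xstar ∧ ∀ y ∈ Xstar, ‖x - proj x‖ ≤ ‖x - y‖)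
    -- projX is the Euclidean projection onto X
    (hprojX : ∀ u, projX u ∈ X ∧ ∀ y ∈ X, ‖u - projX u‖ ≤ ‖u - y‖)
    (hκ : 0 < κ)
    -- f has quadratic functional growth on X with constant κ
    (hqfg : ∀ x ∈ X, f x - fstar ≥ κ / 2 * ‖x - proj x‖ ^ 2)
    -- projected gradient iterates with constant stepsize 1/Lf, started from x⁰ ∈ X
    (x : ℕ → EuclideanSpace ℝ (Fin n))
    (hx0 : x 0 ∈ X)
    (hiter : ∀ k, x (k + 1) = projX (x k - (1 / Lf) • f' (x k)))
    :
    ∀ k : ℕ, ‖x k - proj (x k)‖ ^ 2 ≤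
      (1 / (1 + κ / Lf)) ^ k * ‖x 0 - proj (x 0)‖ ^ 2 := by
  have hmem (k : ℕ) : x k ∈ X := by
    cases k with
    | zero => exact hx0
    | succ k => exact hiter k ▸ (hprojX _).1
  intro k
  induction k with
  | zero => simp
  | succ k ih =>
    have hz : proj (x k) ∈ X := by
      have h := (hproj (x k)).1
      rw [hXstar] at h
      exact h.1
    have hstep := norm_sq_projected_gradient_step_le hXconv hconv hgrad hLf hLip
      (hmem k) (hmem (k + 1)) hz (hiter k ▸ (hprojX _).2)
    rw [hfstar _ (hproj (x k)).1] at hstep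
    have hgrowth : κ / Lf * ‖x (k + 1) - proj (x (k + 1))‖ ^ 2 ≤
        2 / Lf * (f (x (k + 1)) - fstar) := by
      calc κ / Lf * ‖x (k + 1) - proj (x (k + 1))‖ ^ 2
          = 2 / Lf * (κ / 2 * ‖x (k + 1) - proj (x (k + 1))‖ ^ 2) := by ring
        _ ≤ _ := by gcongr; exact hqfg _ (hmem (k + 1))
    have hnear : ‖x (k + 1) - proj (x (k + 1))‖ ^ 2 ≤ ‖x (k + 1) - proj (x k)‖ ^ 2 := by
      gcongr
      exact (hproj (x (k + 1))).2 _ (hproj (x k)).1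
    have hpos : 0 < 1 + κ / Lf := by positivity
    rw [pow_succ' (1 / (1 + κ / Lf)), mul_assoc, one_div_mul_eq_div, le_div_iff₀ hpos]
    linarith
end
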